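/- arXiv:1311.1388 — 3 statements merged into one kernel-verified Lean document; each statement's English description precedes it below -/
import Mathlib

section
/- Let α > 0, β > 0, r > −1 be real numbers, let z ∈ ℝ, and let a < t be real numbers. Then (1/Γ(r+1)) · ∫_a^t e_{α,β}(t−s; z) (s−a)^r ds = e_{α,β+r+1}(t−a; z). -/
open MeasureTheory Real

/-- Generalized Mittag–Leffler function `e_{α,β}(t; z)`. -/
noncomputable def mlE (α β t z : ℝ) : ℝ :=
  ∑' k : ℕ, (-z) ^ k * t ^ (α * (k : ℝ) + β - 1) / Real.Gamma (α * (k : ℝ) + β)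

/-- A lower bound for the Gamma function, from restricting its defining integral to `(M, ∞)`. -/
theorem exp_neg_mul_rpow_le_Gamma {M x : ℝ} (hM : 0 < M) (hx : 1 ≤ x) :
    exp (-M) * M ^ (x - 1) ≤ Real.Gamma x := by
  have hconv := Real.GammaIntegral_convergent (zero_lt_one.trans_le hx)
  have hsub : Set.Ioi M ⊆ Set.Ioi 0 := Set.Ioi_subset_Ioi hM.le
  calc exp (-M) * M ^ (x - 1)
      = ∫ u in Set.Ioi M, exp (-u) * M ^ (x - 1) := by
        rw [integral_mul_const, integral_exp_neg_Ioi]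
    _ ≤ ∫ u in Set.Ioi M, exp (-u) * u ^ (x - 1) := by
        refine setIntegral_mono_on ((integrableOn_exp_neg_Ioi M).mul_const _)
          (hconv.mono_set hsub) measurableSet_Ioi fun u hu => ?_
        have hu' : M < u := hu
        gcongr
    _ ≤ ∫ u in Set.Ioi 0, exp (-u) * u ^ (x - 1) := by
        refine setIntegral_mono_set hconv ?_ hsub.eventuallyLE
        filter_upwards [ae_restrict_mem measurableSet_Ioi] with u hu
        have hu' : 0 < u := hu
        simp only [Pi.zero_apply]
        positivity
    _ = Real.Gamma x := (Real.Gamma_eq_integral (zero_lt_one.trans_le hx)).symm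

theorem summable_pow_div_Gamma {α : ℝ} (γ c : ℝ) (hα : 0 < α) :
    Summable fun k : ℕ => c ^ k / Real.Gamma (α * k + γ) := by
  set M : ℝ := (2 * (|c| + 1)) ^ α⁻¹
  have hM : 0 < M := by positivity
  have hMα : M ^ α = 2 * (|c| + 1) := rpow_inv_rpow (by positivity) hα.ne'
  have hq : |c| / M ^ α < 1 := by
    rw [hMα, div_lt_one (by positivity)]
    linarith [abs_nonneg c]
  refine Summable.of_norm_bounded_eventually_nat
    (g := fun k => exp M * M ^ (1 - γ) * (|c| / M ^ α) ^ k)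
    ((summable_geometric_of_lt_one (by positivity) hq).mul_left _) ?_
  have hlim : Filter.Tendsto (fun k : ℕ => α * (k : ℝ) + γ) Filter.atTop Filter.atTop :=
    Filter.tendsto_atTop_add_const_right _ _
      (tendsto_natCast_atTop_atTop.const_mul_atTop hα)
  filter_upwards [hlim.eventually_ge_atTop 1] with k hk
  have hΓ := exp_neg_mul_rpow_le_Gamma hM hk
  have hpos : 0 < exp (-M) * M ^ (α * k + γ - 1) := by positivity
  have hpow : M ^ (α * k + γ - 1) = (M ^ α) ^ k * (M ^ (1 - γ))⁻¹ := by
    rw [← rpow_natCast, ← rpow_mul hM.le, ← rpow_neg hM.le, ← rpow_add hM]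
    ring_nf
  rw [norm_div, norm_pow, norm_eq_abs, norm_of_nonneg (hpos.le.trans hΓ)]
  calc |c| ^ k / Real.Gamma (α * k + γ)
      ≤ |c| ^ k / (exp (-M) * M ^ (α * k + γ - 1)) := by gcongr
    _ = exp M * M ^ (1 - γ) * (|c| / M ^ α) ^ k := by
        rw [hpow, exp_neg, div_pow]
        field_simp

theorem integral_sub_rpow_mul_sub_rpow {p q a t : ℝ} (hp : 0 < p) (hq : 0 < q) (hat : a < t) :
    ∫ s in a..t, (t - s) ^ (p - 1) * (s - a) ^ (q - 1)
      = (t - a) ^ (p + q - 1) * (Real.Gamma p * Real.Gamma q / Real.Gamma (p + q)) := by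
  have hT : 0 < t - a := sub_pos.2 hat
  have hshift : ∫ s in a..t, (t - s) ^ (p - 1) * (s - a) ^ (q - 1)
      = ∫ x in (0 : ℝ)..(t - a), x ^ (q - 1) * (t - a - x) ^ (p - 1) := by
    have h := intervalIntegral.integral_comp_sub_right (a := a) (b := t)
      (fun x : ℝ => x ^ (q - 1) * (t - a - x) ^ (p - 1)) a
    rw [sub_self] at h
    rw [← h]
    congr 1 with s
    rw [mul_comm, sub_sub_sub_cancel_right]
  have hscaled := Complex.betaIntegral_scaled q p hT
  rw [Complex.betaIntegral_eq_Gamma_mul_div _ _ (by simpa) (by simpa)] at hscaled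
  rw [hshift, ← Complex.ofReal_inj, ← intervalIntegral.integral_ofReal]
  convert hscaled using 1
  · refine intervalIntegral.integral_congr fun x hx => ?_
    rw [Set.uIcc_of_le hT.le] at hx
    simp only [Complex.ofReal_mul, Complex.ofReal_cpow hx.1,
      Complex.ofReal_cpow (sub_nonneg.2 hx.2)]
    push_cast
    rfl
  · simp only [Complex.ofReal_mul, Complex.ofReal_div, Complex.ofReal_cpow hT.le,
      ← Complex.Gamma_ofReal]
    push_cast
    rw [mul_comm (Complex.Gamma p), add_comm (p : ℂ)]

theorem intervalIntegrable_sub_rpow_mul_sub_rpow {p q a t : ℝ} (hp : 0 < p) (hq : 0 < q)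
    (hat : a < t) :
    IntervalIntegrable (fun s => (t - s) ^ (p - 1) * (s - a) ^ (q - 1)) volume a t := by
  by_contra h
  have hT : 0 < t - a := sub_pos.2 hat
  have h₀ := integral_sub_rpow_mul_sub_rpow hp hq hat
  rw [intervalIntegral.integral_undef h] at h₀
  have := Real.Gamma_pos_of_pos hp
  have := Real.Gamma_pos_of_pos hq
  have := Real.Gamma_pos_of_pos (add_pos hp hq)
  exact absurd h₀ (by positivity)

theorem integral_mlE_mul_rpow (α β r z a t : ℝ)
    (hα : 0 < α) (hβ : 0 < β) (hr : -1 < r) (hat : a < t) :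
    (1 / Real.Gamma (r + 1)) * ∫ s in a..t, mlE α β (t - s) z * (s - a) ^ r
      = mlE α (β + r + 1) (t - a) z := by
  have hT : 0 < t - a := sub_pos.2 hat
  have hr₁ : 0 < r + 1 := by linarith
  have hΓr := Real.Gamma_pos_of_pos hr₁
  have hp (k : ℕ) : 0 < α * k + β := by positivity
  have hΓ (k : ℕ) := Real.Gamma_pos_of_pos (hp k)
  set K : ℕ → ℝ → ℝ := fun k s => (t - s) ^ (α * k + β - 1) * (s - a) ^ r
  have hKint (k : ℕ) : IntegrableOn (K k) (Set.Ioc a t) := by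
    simpa [K] using (intervalIntegrable_sub_rpow_mul_sub_rpow (hp k) hr₁ hat).1
  have hKval (k : ℕ) : ∫ s in Set.Ioc a t, K k s = (t - a) ^ (α * k + (β + r + 1) - 1) *
      (Real.Gamma (α * k + β) * Real.Gamma (r + 1) / Real.Gamma (α * k + (β + r + 1))) := by
    have h := integral_sub_rpow_mul_sub_rpow (hp k) hr₁ hat
    rw [intervalIntegral.integral_of_le hat.le] at h
    simpa [K, add_assoc] using h
  set F : ℕ → ℝ → ℝ := fun k s => (-z) ^ k / Real.Gamma (α * k + β) * K k s
  have hFnorm (k : ℕ) : ∫ s in Set.Ioc a t, ‖F k s‖ =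
      Real.Gamma (r + 1) * (t - a) ^ (β + r) *
        ((|z| * (t - a) ^ α) ^ k / Real.Gamma (α * k + (β + r + 1))) := by
    have h : ∫ s in Set.Ioc a t, ‖F k s‖ =
        ∫ s in Set.Ioc a t, |z| ^ k / Real.Gamma (α * k + β) * K k s := by
      refine setIntegral_congr_fun measurableSet_Ioc fun s hs => ?_
      have hK : 0 ≤ K k s :=
        mul_nonneg (rpow_nonneg (sub_nonneg.2 hs.2) _) (rpow_nonneg (sub_nonneg.2 hs.1.le) _)
      simp only [F, norm_mul, norm_div, norm_pow, norm_neg, norm_eq_abs, abs_of_nonneg hK,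
        abs_of_pos (hΓ k)]
    have hpow : (t - a) ^ (α * k + (β + r + 1) - 1) = ((t - a) ^ α) ^ k * (t - a) ^ (β + r) := by
      rw [← rpow_natCast, ← rpow_mul hT.le, ← rpow_add hT]
      ring_nf
    rw [h, integral_const_mul, hKval, hpow, mul_pow]
    have := (hΓ k).ne'
    field_simp
  have hsum : HasSum (fun k => ∫ s in Set.Ioc a t, F k s) (∫ s in Set.Ioc a t, ∑' k, F k s) := by
    refine hasSum_integral_of_summable_integral_norm (fun k => (hKint k).const_mul _) ?_
    simp_rw [hFnorm]
    exact (summable_pow_div_Gamma _ _ hα).mul_left _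
  have hswap : ∫ s in a..t, mlE α β (t - s) z * (s - a) ^ r =
      ∫ s in Set.Ioc a t, ∑' k, F k s := by
    rw [intervalIntegral.integral_of_le hat.le]
    congr 1 with s
    rw [mlE, ← tsum_mul_right]
    congr 1 with k
    simp only [F, K]
    ring
  rw [hswap, ← hsum.tsum_eq, ← tsum_mul_left, mlE]
  congr 1 with k
  rw [integral_const_mul, hKval]
  have := (hΓ k).ne'
  field_simp
end

section
/- Let α > 0, β > 0, k ∈ ℕ, z ∈ ℝ, and let a < b ≤ t be real numbers with h = b − a. Then R_{α,β,k}(t, a, b; z) = h^{β+k} · R_{α,β,k}((t−a)/h, 0, 1; h^α z). -/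
open MeasureTheory Real

/-- The weighted integral `R_{α,β,r}(t, a, b; z)`. -/
noncomputable def Rml (α β r t a b z : ℝ) : ℝ :=
  (1 / Real.Gamma (r + 1)) * ∫ s in a..b, mlE α β (t - s) z * (s - a) ^ r

theorem mlE_mul_left (α β z : ℝ) {c t : ℝ} (hc : 0 < c) (ht : 0 ≤ t) :
    mlE α β (c * t) z = c ^ (β - 1) * mlE α β t (c ^ α * z) := by
  unfold mlE
  rw [← tsum_mul_left]
  refine tsum_congr fun n => ?_
  have hpow : c ^ (α * (n : ℝ) + β - 1) = (c ^ α) ^ n * c ^ (β - 1) := by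
    rw [add_sub_assoc, rpow_add hc, rpow_mul hc.le, rpow_natCast]
  rw [mul_rpow hc.le ht, hpow, ← mul_neg, mul_pow]
  ring

theorem Rml_scaling (α β z a b t : ℝ) (k : ℕ)
    (hα : 0 < α) (hβ : 0 < β) (hab : a < b) (hbt : b ≤ t) :
    Rml α β k t a b z
      = (b - a) ^ (β + (k : ℝ))
          * Rml α β k ((t - a) / (b - a)) 0 1 ((b - a) ^ α * z) := by
  have hh : 0 < b - a := sub_pos.2 hab
  have hsubst := intervalIntegral.mul_integral_comp_add_mul (a := 0) (b := 1)
    (f := fun s => mlE α β (t - s) z * (s - a) ^ (k : ℝ)) (b - a) a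
  rw [mul_zero, add_zero, mul_one, add_sub_cancel] at hsubst
  have hscale : ∀ u ∈ Set.uIcc (0 : ℝ) 1,
      mlE α β (t - (a + (b - a) * u)) z * (a + (b - a) * u - a) ^ (k : ℝ)
        = (b - a) ^ (β - 1) * (b - a) ^ (k : ℝ) *
          (mlE α β ((t - a) / (b - a) - u) ((b - a) ^ α * z) * (u - 0) ^ (k : ℝ)) := by
    intro u hu
    rw [Set.uIcc_of_le zero_le_one] at hu
    have hτ : 0 ≤ (t - a) / (b - a) - u := by
      have : 1 ≤ (t - a) / (b - a) := (one_le_div hh).2 (by linarith)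
      linarith [hu.2]
    have harg : t - (a + (b - a) * u) = (b - a) * ((t - a) / (b - a) - u) := by
      field_simp
      ring
    rw [harg, mlE_mul_left α β z hh hτ, add_sub_cancel_left, sub_zero, mul_rpow hh.le hu.1]
    ring
  have hpow : (b - a) ^ (β + (k : ℝ))
      = (b - a) * ((b - a) ^ (β - 1) * (b - a) ^ (k : ℝ)) := by
    rw [rpow_add hh, rpow_sub_one hh.ne']
    field_simp
  unfold Rml
  rw [← hsubst, intervalIntegral.integral_congr hscale, intervalIntegral.integral_const_mul, hpow]
  ring
end

section
/- Let 0 ≤ j < n be integers and K ∈ ℕ, and let f : [t_j, t_{j+1}] → ℝ be (K+1) times continuously differentiable. If T_{n,j}[p] = 0 for every polynomial p of degree at most K, then T_{n,j}[f] = ∫_{t_j}^{t_{j+1}} (f^{(K+1)}(ξ)/K!) · T_{n,j}[G_{ξ,K}] dξ. -/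
open MeasureTheory Real

/-- The generalized step function `G_{ξ,k}(t) = (t-ξ)_+^k`. -/
noncomputable def stepG (ξ : ℝ) (k : ℕ) (t : ℝ) : ℝ :=
  if ξ ≤ t then (t - ξ) ^ k else 0

/-- The quadrature remainder `T_{n,j}[g] = I_j[g,t_n] - Q_{n,j}[g]` for the mesh
`t_j = t_0 + j h`, nodes `c` and weights `b`. -/
noncomputable def quadT (α lam t0 h : ℝ) {ν : ℕ} (c : Fin ν → ℝ) (b : Fin ν → ℕ → ℝ)
    (n j : ℕ) (g : ℝ → ℝ) : ℝ :=
  (∫ s in (t0 + (j : ℝ) * h)..(t0 + ((j : ℝ) + 1) * h),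
      mlE α α (t0 + (n : ℝ) * h - s) lam * g s)
    - ∑ r, b r (n - j) * g (t0 + (j : ℝ) * h + c r * h)

theorem rpow_mul_exp_neg_le_Gamma {R s : ℝ} (hR : 0 ≤ R) (hs : 1 ≤ s) :
    R ^ (s - 1) * exp (-R) ≤ Real.Gamma s := by
  have hint := Real.GammaIntegral_convergent (zero_lt_one.trans_le hs)
  have hsub : Set.Ioi R ⊆ Set.Ioi 0 := Set.Ioi_subset_Ioi hR
  rw [Real.Gamma_eq_integral (zero_lt_one.trans_le hs), ← integral_exp_neg_Ioi,
    ← integral_const_mul]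
  calc ∫ x in Set.Ioi R, R ^ (s - 1) * exp (-x)
      ≤ ∫ x in Set.Ioi R, exp (-x) * x ^ (s - 1) := by
        refine setIntegral_mono_on ((integrableOn_exp_neg_Ioi R).const_mul _)
          (hint.mono_set hsub) measurableSet_Ioi fun x hx => ?_
        rw [mul_comm]
        have := Real.rpow_le_rpow hR (le_of_lt hx) (sub_nonneg.2 hs)
        gcongr
    _ ≤ _ := by
        refine setIntegral_mono_set hint ?_ hsub.eventuallyLE
        filter_upwards [ae_restrict_mem measurableSet_Ioi] with x hx
        exact mul_nonneg (exp_pos _).le (Real.rpow_nonneg (le_of_lt hx) _)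

/-- Absolute convergence of the Mittag–Leffler series, with the singular factor split off. -/
theorem summable_mittagLeffler {α : ℝ} (hα : 0 < α) (z : ℝ) {H : ℝ} (hH : 0 < H) :
    Summable fun k : ℕ => |z| ^ k * H ^ (α * (k : ℝ)) / Real.Gamma (α * k + α) := by
  set R : ℝ := H * (|z| + 1) ^ α⁻¹ with hRdef
  have hz : 0 < |z| + 1 := by positivity
  have hR : 0 < R := by positivity
  have hRα : R ^ α = H ^ α * (|z| + 1) := by
    rw [hRdef, Real.mul_rpow hH.le (by positivity), Real.rpow_inv_rpow hz.le hα.ne']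
  have hgeom : Summable fun k : ℕ => exp R * R ^ (1 - α) * (|z| / (|z| + 1)) ^ k :=
    (summable_geometric_of_lt_one (by positivity)
      ((div_lt_one hz).2 (lt_add_one _))).mul_left _
  refine Summable.of_norm_bounded_eventually_nat hgeom ?_
  obtain ⟨N, hN⟩ := exists_nat_gt (1 / α)
  filter_upwards [Filter.eventually_ge_atTop N] with k hk
  have hs : 1 ≤ α * (k : ℝ) + α := by
    have : (N : ℝ) ≤ k := by exact_mod_cast hk
    have h1 : 1 < α * N := by rwa [div_lt_iff₀' hα] at hN
    nlinarith
  have hΓ := rpow_mul_exp_neg_le_Gamma hR.le hs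
  rw [Real.norm_of_nonneg (div_nonneg (by positivity)
    (Real.Gamma_pos_of_pos (by linarith)).le)]
  calc |z| ^ k * H ^ (α * (k : ℝ)) / Real.Gamma (α * k + α)
      ≤ |z| ^ k * H ^ (α * (k : ℝ)) / (R ^ (α * (k : ℝ) + α - 1) * exp (-R)) := by gcongr
    _ = _ := by
      have h1 : R ^ (α * (k : ℝ) + α - 1) = (H ^ (α * (k : ℝ)) * (|z| + 1) ^ k) / R ^ (1 - α) := by
        rw [show α * (k : ℝ) + α - 1 = α * k - (1 - α) by ring, Real.rpow_sub hR,
          Real.rpow_mul hR.le, hRα, Real.rpow_natCast, mul_pow, Real.rpow_mul hH.le,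
          Real.rpow_natCast]
      rw [h1, exp_neg, div_pow]
      have := (Real.rpow_pos_of_pos hH (α * k)).ne'
      have := (Real.rpow_pos_of_pos hR (1 - α)).ne'
      have := exp_ne_zero R
      field_simp

theorem exists_abs_mlE_le {α : ℝ} (hα : 0 < α) (z : ℝ) {H : ℝ} (hH : 0 < H) :
    ∃ C, ∀ t, 0 < t → t ≤ H → |mlE α α t z| ≤ C * t ^ (α - 1) := by
  refine ⟨∑' k : ℕ, |z| ^ k * H ^ (α * (k : ℝ)) / Real.Gamma (α * k + α),
    fun t ht htH => ?_⟩
  rw [mlE, ← Real.norm_eq_abs]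
  refine tsum_of_norm_bounded
    ((summable_mittagLeffler hα z hH).hasSum.mul_right (t ^ (α - 1))) fun k => ?_
  have hΓ : 0 < Real.Gamma (α * (k : ℝ) + α) := Real.Gamma_pos_of_pos (by positivity)
  rw [norm_div, norm_mul, norm_pow, norm_neg, Real.norm_eq_abs, Real.norm_of_nonneg hΓ.le,
    Real.norm_of_nonneg (by positivity), add_sub_assoc, Real.rpow_add ht, div_mul_eq_mul_div,
    ← mul_assoc]
  gcongr

theorem measurable_mlE (α β z : ℝ) : Measurable fun t => mlE α β t z := by
  unfold mlE
  exact Measurable.tsum fun k => by fun_prop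

theorem intervalIntegrable_mlE {α : ℝ} (hα : 0 < α) (z : ℝ) {a b T : ℝ} (hab : a ≤ b)
    (hbT : b ≤ T) : IntervalIntegrable (fun s => mlE α α (T - s) z) volume a b := by
  obtain ⟨C, hC⟩ := exists_abs_mlE_le hα z (H := T - a + 1) (by linarith)
  have hpow : IntervalIntegrable (fun s : ℝ => C * (T - s) ^ (α - 1)) volume a b := by
    have h := (intervalIntegral.intervalIntegrable_rpow' (a := T - a) (b := T - b)
      (r := α - 1) (by linarith)).comp_sub_left T
    simpa using h.const_mul C
  refine hpow.mono_fun
    ((measurable_mlE α α z).comp (measurable_const.sub measurable_id)).aestronglyMeasurable ?_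
  rw [Set.uIoc_of_le hab]
  filter_upwards [ae_restrict_mem measurableSet_Ioc, ae_restrict_of_ae (volume.ae_ne T)]
    with s hs hsT
  have hlt : s < T := lt_of_le_of_ne (hs.2.trans hbT) hsT
  exact (hC (T - s) (sub_pos.2 hlt) (by linarith [hs.1])).trans (le_abs_self _)

theorem measurable_stepG_uncurry (k : ℕ) :
    Measurable fun p : ℝ × ℝ => stepG p.1 k p.2 := by
  unfold stepG
  exact Measurable.ite (measurableSet_le measurable_fst measurable_snd) (by fun_prop)
    measurable_const

theorem abs_stepG_le {a b ξ t : ℝ} (hξ : ξ ∈ Set.Icc a b) (ht : t ∈ Set.Icc a b) (k : ℕ) :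
    |stepG ξ k t| ≤ (b - a) ^ k := by
  have hab : 0 ≤ b - a := by linarith [hξ.1, hξ.2]
  unfold stepG
  split_ifs with h
  · rw [abs_of_nonneg (by have := sub_nonneg.2 h; positivity)]
    exact pow_le_pow_left₀ (sub_nonneg.2 h) (by linarith [hξ.1, ht.2]) k
  · simpa using pow_nonneg hab k

/-- Taylor's formula with integral remainder, the remainder written over the whole interval. -/
theorem exists_polynomial_add_integral_stepG {a b : ℝ} (hab : a < b) {K : ℕ} {f : ℝ → ℝ}
    (hf : ContDiffOn ℝ (K + 1) f (Set.Icc a b)) :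
    ∃ p : Polynomial ℝ, p.natDegree ≤ K ∧ ∀ t ∈ Set.Icc a b,
      f t = p.eval t + ∫ ξ in a..b,
        iteratedDerivWithin (K + 1) f (Set.Icc a b) ξ / (K.factorial : ℝ) * stepG ξ K t := by
  have hg : ContinuousOn (iteratedDerivWithin (K + 1) f (Set.Icc a b)) (Set.Icc a b) :=
    hf.continuousOn_iteratedDerivWithin (by norm_cast) (uniqueDiffOn_Icc hab)
  have hfK : ContDiffOn ℝ K f (Set.Icc a b) := hf.of_le (by norm_cast; omega)
  have hdiff : DifferentiableOn ℝ (iteratedDerivWithin K f (Set.Icc a b)) (Set.Icc a b) :=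
    hf.differentiableOn_iteratedDerivWithin (by norm_cast; omega) (uniqueDiffOn_Icc hab)
  refine ⟨∑ k ∈ Finset.range (K + 1), Polynomial.C ((k.factorial : ℝ)⁻¹ *
    iteratedDerivWithin k f (Set.Icc a b) a) * (Polynomial.X - Polynomial.C a) ^ k, ?_, ?_⟩
  · refine Polynomial.natDegree_sum_le_of_forall_le _ _ fun k hk => ?_
    refine (Polynomial.natDegree_C_mul_le _ _).trans ?_
    rw [Polynomial.natDegree_pow, Polynomial.natDegree_X_sub_C]
    have := Finset.mem_range.1 hk
    omega
  intro t ht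
  have hFTC := intervalIntegral.integral_eq_sub_of_hasDerivAt_of_le ht.1
    ((continuousOn_taylorWithinEval (x := t) (uniqueDiffOn_Icc hab) hfK).mono
      (Set.Icc_subset_Icc_right ht.2))
    (fun y hy => taylorWithinEval_hasDerivAt_Ioo t hab ⟨hy.1, hy.2.trans_le ht.2⟩ hfK
      (hdiff.mono Set.Ioo_subset_Icc_self))
    (ContinuousOn.intervalIntegrable_of_Icc ht.1 (by
      have := hg.mono (Set.Icc_subset_Icc_right ht.2)
      fun_prop))
  rw [taylorWithinEval_self, taylor_within_apply] at hFTC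
  have hstep : ∫ ξ in a..b,
      iteratedDerivWithin (K + 1) f (Set.Icc a b) ξ / (K.factorial : ℝ) * stepG ξ K t
      = ∫ ξ in a..t, (((K.factorial : ℝ)⁻¹ * (t - ξ) ^ K) •
          iteratedDerivWithin (K + 1) f (Set.Icc a b) ξ) := by
    rw [intervalIntegral.integral_of_le hab.le, intervalIntegral.integral_of_le ht.1,
      ← min_eq_right ht.2, ← Set.Ioc_inter_Iic, ← setIntegral_indicator measurableSet_Iic,
      min_eq_right ht.2]
    refine integral_congr_ae (.of_forall fun ξ => ?_)
    by_cases h : ξ ≤ t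
    · simp only [stepG, h, Set.mem_Iic, Set.indicator_of_mem, if_true, smul_eq_mul]
      ring
    · simp [stepG, h]
  rw [hstep, hFTC, Polynomial.eval_finsetSum]
  simp only [Polynomial.eval_mul, Polynomial.eval_C, Polynomial.eval_pow, Polynomial.eval_sub,
    Polynomial.eval_X, smul_eq_mul]
  rw [← add_sub_assoc, eq_sub_iff_add_eq, add_comm]
  congr 1
  exact Finset.sum_congr rfl fun k _ => by ring

theorem integrable_prod_mul_stepG {a b : ℝ} {w g : ℝ → ℝ}
    (hw : IntervalIntegrable w volume a b) (hg : IntervalIntegrable g volume a b) (K : ℕ) :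
    Integrable (fun p : ℝ × ℝ => w p.1 * (g p.2 * stepG p.2 K p.1))
      ((volume.restrict (Set.Ioc a b)).prod (volume.restrict (Set.Ioc a b))) := by
  have h := (hw.1.mul_prod hg.1).mul_bdd (c := (b - a) ^ K)
    (g := fun p : ℝ × ℝ => stepG p.2 K p.1)
    ((measurable_stepG_uncurry K).comp measurable_swap).aestronglyMeasurable ?_
  · simpa only [mul_assoc] using h
  · rw [Measure.prod_restrict]
    filter_upwards [ae_restrict_mem (measurableSet_Ioc.prod measurableSet_Ioc)] with p hp
    exact abs_stepG_le (Set.Ioc_subset_Icc_self hp.2) (Set.Ioc_subset_Icc_self hp.1) K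

theorem intervalIntegrable_mul_stepG {a b t : ℝ} (hab : a ≤ b) (ht : t ∈ Set.Icc a b)
    {g : ℝ → ℝ} (hg : IntervalIntegrable g volume a b) (K : ℕ) :
    IntervalIntegrable (fun ξ => g ξ * stepG ξ K t) volume a b := by
  rw [intervalIntegrable_iff_integrableOn_Ioc_of_le hab]
  refine hg.1.mul_bdd (c := (b - a) ^ K)
    ((measurable_stepG_uncurry K).comp (measurable_id.prodMk measurable_const)
      ).aestronglyMeasurable ?_
  filter_upwards [ae_restrict_mem measurableSet_Ioc] with ξ hξ
  exact abs_stepG_le (Set.Ioc_subset_Icc_self hξ) ht K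

/-- The Peano kernel theorem for the remainder of a weighted quadrature rule. -/
theorem peano_kernel_of_intervalIntegrable {a b : ℝ} (hab : a < b) {w : ℝ → ℝ}
    (hw : IntervalIntegrable w volume a b) {ι : Type*} [Fintype ι] (x β : ι → ℝ)
    (hx : ∀ i, x i ∈ Set.Icc a b) {K : ℕ} {f : ℝ → ℝ}
    (hf : ContDiffOn ℝ (K + 1) f (Set.Icc a b))
    (hexact : ∀ p : Polynomial ℝ, p.natDegree ≤ K →
      (∫ s in a..b, w s * p.eval s) - ∑ i, β i * p.eval (x i) = 0) :
    (∫ s in a..b, w s * f s) - ∑ i, β i * f (x i) =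
      ∫ ξ in a..b, (iteratedDerivWithin (K + 1) f (Set.Icc a b) ξ / (K.factorial : ℝ)) *
        ((∫ s in a..b, w s * stepG ξ K s) - ∑ i, β i * stepG ξ K (x i)) := by
  obtain ⟨p, hp, hfp⟩ := exists_polynomial_add_integral_stepG hab hf
  set g : ℝ → ℝ := fun ξ =>
    iteratedDerivWithin (K + 1) f (Set.Icc a b) ξ / (K.factorial : ℝ) with hgdef
  have hg : IntervalIntegrable g volume a b :=
    ((hf.continuousOn_iteratedDerivWithin (by norm_cast) (uniqueDiffOn_Icc hab)).div_const
      _).intervalIntegrable_of_Icc hab.le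
  have hF := integrable_prod_mul_stepG hw hg K
  have hleft : IntervalIntegrable (fun s => w s * ∫ ξ in a..b, g ξ * stepG ξ K s)
      volume a b := by
    rw [intervalIntegrable_iff_integrableOn_Ioc_of_le hab.le]
    simpa only [IntegrableOn, integral_const_mul, intervalIntegral.integral_of_le hab.le]
      using hF.integral_prod_left
  have hpull : ∀ ξ s, w s * (g ξ * stepG ξ K s) = g ξ * (w s * stepG ξ K s) :=
    fun ξ s => by ring
  have hright : IntervalIntegrable (fun ξ => g ξ * ∫ s in a..b, w s * stepG ξ K s)
      volume a b := by
    rw [intervalIntegrable_iff_integrableOn_Ioc_of_le hab.le]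
    simpa only [IntegrableOn, hpull, integral_const_mul,
      intervalIntegral.integral_of_le hab.le] using hF.integral_prod_right
  have hswap : ∫ s in a..b, w s * ∫ ξ in a..b, g ξ * stepG ξ K s =
      ∫ ξ in a..b, g ξ * ∫ s in a..b, w s * stepG ξ K s := by
    simp only [intervalIntegral.integral_of_le hab.le, ← integral_const_mul, ← hpull]
    exact integral_integral_swap (f := fun s ξ => w s * (g ξ * stepG ξ K s)) hF
  have hwp : IntervalIntegrable (fun s => w s * p.eval s) volume a b :=
    hw.mul_continuousOn p.continuous.continuousOn
  have hnode : ∀ i, IntervalIntegrable (fun ξ => β i * (g ξ * stepG ξ K (x i))) volume a b :=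
    fun i => (intervalIntegrable_mul_stepG hab.le (hx i) hg K).const_mul _
  have hI : ∫ s in a..b, w s * f s = (∫ s in a..b, w s * p.eval s) +
      ∫ ξ in a..b, g ξ * ∫ s in a..b, w s * stepG ξ K s := by
    rw [← hswap, ← intervalIntegral.integral_add hwp hleft]
    refine intervalIntegral.integral_congr fun s hs => ?_
    rw [Set.uIcc_of_le hab.le] at hs
    simp only [hfp s hs, mul_add, hgdef]
  have hQ : ∑ i, β i * f (x i) = ∑ i, β i * p.eval (x i) +
      ∫ ξ in a..b, ∑ i, β i * (g ξ * stepG ξ K (x i)) := by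
    rw [intervalIntegral.integral_finsetSum fun i _ => hnode i, ← Finset.sum_add_distrib]
    refine Finset.sum_congr rfl fun i _ => ?_
    rw [intervalIntegral.integral_const_mul, hfp _ (hx i), mul_add]
  have hsum : IntervalIntegrable (fun ξ => ∑ i, β i * (g ξ * stepG ξ K (x i))) volume a b := by
    simpa only [Finset.sum_fn] using IntervalIntegrable.sum Finset.univ fun i _ => hnode i
  rw [hI, hQ, add_sub_add_comm, hexact p hp, zero_add,
    ← intervalIntegral.integral_sub hright hsum]
  refine intervalIntegral.integral_congr fun ξ _ => ?_
  simp only [mul_sub, Finset.mul_sum, mul_left_comm (β _)]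
  rfl

theorem peano_kernel_representation (α lam t0 h : ℝ) (hα : 0 < α) (hh : 0 < h) (ν : ℕ)
    (c : Fin ν → ℝ) (hc : ∀ r, c r ∈ Set.Icc (0 : ℝ) 1) (b : Fin ν → ℕ → ℝ)
    (n j K : ℕ) (hjn : j < n) (f : ℝ → ℝ)
    (hf : ContDiffOn ℝ (K + 1) f
      (Set.Icc (t0 + (j : ℝ) * h) (t0 + ((j : ℝ) + 1) * h)))
    (hexact : ∀ p : Polynomial ℝ, p.natDegree ≤ K →
      quadT α lam t0 h c b n j (fun x => p.eval x) = 0) :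
    quadT α lam t0 h c b n j f
      = ∫ ξ in (t0 + (j : ℝ) * h)..(t0 + ((j : ℝ) + 1) * h),
          (iteratedDerivWithin (K + 1) f
              (Set.Icc (t0 + (j : ℝ) * h) (t0 + ((j : ℝ) + 1) * h)) ξ
            / (K.factorial : ℝ))
            * quadT α lam t0 h c b n j (stepG ξ K) := by
  have hab : t0 + (j : ℝ) * h < t0 + ((j : ℝ) + 1) * h := by linarith
  have hjn' : (j : ℝ) + 1 ≤ n := by exact_mod_cast hjn
  have hbT : t0 + ((j : ℝ) + 1) * h ≤ t0 + (n : ℝ) * h := by gcongr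
  refine peano_kernel_of_intervalIntegrable hab (intervalIntegrable_mlE hα lam hab.le hbT)
    (fun r => t0 + (j : ℝ) * h + c r * h) (fun r => b r (n - j)) (fun r => ?_) hf hexact
  obtain ⟨h0, h1⟩ := hc r
  constructor <;> nlinarith
end
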